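/- Let U, V ∈ ℝ^{n×d}, f : ℝ → ℝ, and c_0,…,c_r ∈ ℝ, and suppose |f(x) − Σ_{j=0}^r c_j x^j| ≤ ε for all x in a closed interval containing every entry of UVᵀ, for some ε > 0. Then the Poly-TensorSketch output Γ satisfies E[ ‖f⊙(UVᵀ) − Γ‖_F² ] ≤ 2 n² ε² + Σ_{j=1}^r 2 r c_j² (2 + 3^j) (Σ_{i=1}^n (Σ_{k=1}^d U_{ik}²)^j) (Σ_{i=1}^n (Σ_{k=1}^d V_{ik}²)^j) / m. -/

import Mathlib

open Matrix
open scoped BigOperators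

noncomputable section

def sgn (b : Bool) : ℝ := if b then 1 else -1

def tSketch {d m : ℕ} [NeZero m] (k : ℕ) (h : Fin k → Fin d → Fin m)
    (s : Fin k → Fin d → Bool) (u : Fin d → ℝ) : Fin m → ℝ :=
  fun j => ∑ i : Fin k → Fin d,
    if (∑ t, h t (i t)) = j then ∏ t, (sgn (s t (i t)) * u (i t)) else 0

def tSketchM {n d m : ℕ} [NeZero m] (k : ℕ) (h : Fin k → Fin d → Fin m)
    (s : Fin k → Fin d → Bool) (U : Matrix (Fin n) (Fin d) ℝ) :
    Matrix (Fin n) (Fin m) ℝ :=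
  Matrix.of fun i => tSketch k h s (U i)

def frobSq {α β : Type*} [Fintype α] [Fintype β] (A : Matrix α β ℝ) : ℝ :=
  ∑ i, ∑ j, (A i j)^2

def expHS {k d m : ℕ}
    (F : (Fin k → Fin d → Fin m) → (Fin k → Fin d → Bool) → ℝ) : ℝ :=
  (∑ h : Fin k → Fin d → Fin m, ∑ s : Fin k → Fin d → Bool, F h s) /
    ((Fintype.card (Fin k → Fin d → Fin m)) * (Fintype.card (Fin k → Fin d → Bool)))

/-- Output of Poly-TensorSketch: `Γ = Σ_{j=0}^r c_j T_U^{(j)} T_V^{(j)ᵀ}`,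
where `T_U^{(j)}` is built from `h 0, …, h (j-1)` and `s 0, …, s (j-1)`. -/
def ptsGamma {n d m : ℕ} [NeZero m] (r : ℕ) (c : Fin (r + 1) → ℝ)
    (h : Fin r → Fin d → Fin m) (s : Fin r → Fin d → Bool)
    (U V : Matrix (Fin n) (Fin d) ℝ) : Matrix (Fin n) (Fin n) ℝ :=
  ∑ j : Fin (r + 1),
    c j • (tSketchM (j : ℕ)
        (fun t => h ⟨t.1, lt_of_lt_of_le t.2 (Nat.lt_succ_iff.mp j.2)⟩)
        (fun t => s ⟨t.1, lt_of_lt_of_le t.2 (Nat.lt_succ_iff.mp j.2)⟩) U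
      * (tSketchM (j : ℕ)
        (fun t => h ⟨t.1, lt_of_lt_of_le t.2 (Nat.lt_succ_iff.mp j.2)⟩)
        (fun t => s ⟨t.1, lt_of_lt_of_le t.2 (Nat.lt_succ_iff.mp j.2)⟩) V)ᵀ)


open scoped Finset
open scoped BigOperators

lemma pts_avg_marginal {α : Type*} [Fintype α] [Nonempty α] {k r : ℕ} (hkr : k ≤ r)
    (F : (Fin k → α) → ℝ) :
    (𝔼 x : Fin r → α, F (fun t => x ⟨t.1, lt_of_lt_of_le t.2 hkr⟩)) = 𝔼 x : Fin k → α, F x := by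
  obtain ⟨l, rfl⟩ := Nat.exists_eq_add_of_le hkr
  have := Fintype.expect_equiv (Fin.appendEquiv k l (α := α)) (fun p => F p.1)
    (fun x => F (fun t => x ⟨t.1, lt_of_lt_of_le t.2 hkr⟩)) (by
      rintro ⟨p, q⟩
      congr 1
      funext t
      exact (Fin.append_left p q t).symm)
  rw [← this, ← Finset.univ_product_univ, Finset.expect_product]
  simp

lemma pts_avg_prod {α : Type*} [Fintype α] {k : ℕ} (G : Fin k → α → ℝ) :
    (𝔼 x : Fin k → α, ∏ t, G t (x t)) = ∏ t, 𝔼 y : α, G t y := by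
  classical
  simp only [Fintype.expect_eq_sum_div_card, Finset.prod_div_distrib]
  rw [Finset.prod_univ_sum]
  simp [Fintype.piFinset_univ]

lemma pts_sgn_sq (b : Bool) : sgn b * sgn b = 1 := by cases b <;> simp [sgn]

def ptsE {d : ℕ} (a b c e : Fin d) : ℝ :=
  𝔼 s : Fin d → Bool, sgn (s a) * sgn (s b) * (sgn (s c) * sgn (s e))

lemma ptsE_flip {d : ℕ} (x a b c e : Fin d) :
    ptsE a b c e = (if a = x then -1 else 1) * (if b = x then -1 else 1)
      * ((if c = x then -1 else 1) * (if e = x then -1 else 1)) * ptsE a b c e := by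
  have hinv : Function.Involutive
      (fun (s : Fin d → Bool) => fun y => xor (s y) (decide (y = x))) := by
    intro s; funext y; simp
  have hs : ∀ (s : Fin d → Bool) (y : Fin d), sgn (xor (s y) (decide (y = x)))
      = (if y = x then -1 else 1) * sgn (s y) := by
    intro s y
    by_cases h : y = x <;> cases hy : s y <;> simp [h, sgn]
  conv_lhs => unfold ptsE
  rw [← Fintype.expect_equiv hinv.toPerm (fun s => sgn (xor (s a) (decide (a = x))) *
    sgn (xor (s b) (decide (b = x))) * (sgn (xor (s c) (decide (c = x))) *
    sgn (xor (s e) (decide (e = x)))))]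
  · unfold ptsE
    rw [Finset.mul_expect]
    refine Finset.expect_congr rfl fun s _ => ?_
    rw [hs, hs, hs, hs]
    ring
  · intro s; rfl

def ptsB {d : ℕ} (a b c e : Fin d) : ℝ :=
  (if a = b ∧ c = e then 1 else 0) + (if a = c ∧ b = e then 1 else 0)
    + (if a = e ∧ b = c then 1 else 0)

lemma ptsE_abs_le_one {d : ℕ} (a b c e : Fin d) : |ptsE a b c e| ≤ 1 := by
  unfold ptsE
  refine (Finset.abs_expect_le _ _).trans ?_
  have : ∀ b, |sgn b| = 1 := by intro b; cases b <;> simp [sgn]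
  simp [abs_mul, this]

lemma ptsE_abs_le {d : ℕ} (a b c e : Fin d) : |ptsE a b c e| ≤ ptsB a b c e := by
  by_cases h : (a = b ∧ c = e) ∨ (a = c ∧ b = e) ∨ (a = e ∧ b = c)
  · refine (ptsE_abs_le_one a b c e).trans ?_
    unfold ptsB
    rcases h with h | h | h
    · rw [if_pos h]; split_ifs <;> norm_num
    · rw [if_pos h]; split_ifs <;> norm_num
    · rw [if_pos h]; split_ifs <;> norm_num
  · have h0 : ptsE a b c e = 0 := by
      have ha := ptsE_flip a a b c e
      have hb := ptsE_flip b a b c e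
      have hc := ptsE_flip c a b c e
      generalize ptsE a b c e = z at *
      by_cases h1 : a = b
      · subst h1
        have hce : ¬ e = c := fun h' => h (Or.inl ⟨rfl, h'.symm⟩)
        by_cases h2 : a = c <;> simp [hce, h2] at hc <;> linarith
      · by_cases h2 : a = c
        · subst h2
          have hce : ¬ e = b := fun h' => h (Or.inr (Or.inl ⟨rfl, h'.symm⟩))
          simp [hce, h1] at hb; linarith
        · by_cases h3 : a = e
          · subst h3
            have hce : ¬ c = b := fun h' => h (Or.inr (Or.inr ⟨rfl, h'.symm⟩))
            simp [hce, h1] at hb; linarith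
          · simp [Ne.symm h1, Ne.symm h2, Ne.symm h3] at ha; linarith
    rw [h0, abs_zero]
    unfold ptsB
    positivity

lemma pts_coll {k d m : ℕ} [NeZero m] (i i' : Fin k → Fin d) (hi : i ≠ i') :
    (𝔼 h : Fin k → Fin d → Fin m,
      (if (∑ t, h t (i t)) = ∑ t, h t (i' t) then (1 : ℝ) else 0)) = 1 / m := by
  obtain ⟨t0, ht0⟩ := Function.ne_iff.mp hi
  have hm : (m : ℝ) ≠ 0 := by exact_mod_cast NeZero.ne m
  have key : ∀ g : Fin m, (𝔼 h : Fin k → Fin d → Fin m,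
      (if (∑ t, h t (i t)) = ∑ t, h t (i' t) then (1 : ℝ) else 0))
      = 𝔼 h : Fin k → Fin d → Fin m,
      (if g = (∑ t, h t (i' t)) - (∑ t, h t (i t)) then (1 : ℝ) else 0) := by
    intro g
    symm
    refine Fintype.expect_equiv (Equiv.addRight (Pi.single t0 (Pi.single (i t0) g))) _ _ ?_
    intro h
    have h1 : ∑ t, (h + Pi.single t0 (Pi.single (i t0) g) : Fin k → Fin d → Fin m) t (i t) = (∑ t, h t (i t)) + g := by
      simp only [Pi.add_apply, Finset.sum_add_distrib]
      congr 1
      rw [Finset.sum_eq_single t0]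
      · simp
      · intro t _ ht; simp [Pi.single_eq_of_ne ht]
      · simp
    have h2 : ∑ t, (h + Pi.single t0 (Pi.single (i t0) g) : Fin k → Fin d → Fin m) t (i' t) = ∑ t, h t (i' t) := by
      simp only [Pi.add_apply, Finset.sum_add_distrib]
      rw [add_eq_left]
      refine Finset.sum_eq_zero fun t _ => ?_
      by_cases ht : t = t0
      · subst ht; simp [Pi.single_eq_of_ne ht0.symm]
      · simp [Pi.single_eq_of_ne ht]
    simp only [Equiv.coe_addRight, h1, h2]
    congr 1
    rw [eq_sub_iff_add_eq, add_comm]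
  have hsum : ∑ g : Fin m, (𝔼 h : Fin k → Fin d → Fin m,
      (if g = (∑ t, h t (i' t)) - (∑ t, h t (i t)) then (1 : ℝ) else 0)) = 1 := by
    rw [← Finset.expect_sum_comm]
    simp
  rw [← Finset.sum_congr rfl (fun g _ => key g), Finset.sum_const, Finset.card_univ,
    Fintype.card_fin, nsmul_eq_mul] at hsum
  rw [eq_div_iff hm, mul_comm]
  exact hsum

lemma pts_coll2 {k d m : ℕ} [NeZero m] (i i' p p' : Fin k → Fin d) (hi : i ≠ i') :
    |𝔼 h : Fin k → Fin d → Fin m,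
      (if (∑ t, h t (i t)) = ∑ t, h t (i' t) then (1 : ℝ) else 0) *
      (if (∑ t, h t (p t)) = ∑ t, h t (p' t) then (1 : ℝ) else 0)| ≤ 1 / m := by
  rw [← pts_coll (m := m) i i' hi]
  refine (Finset.abs_expect_le _ _).trans ?_
  refine Finset.expect_le_expect fun h _ => ?_
  split_ifs <;> simp

def ptsD {k d m : ℕ} [NeZero m] (h : Fin k → Fin d → Fin m) (s : Fin k → Fin d → Bool)
    (u v : Fin d → ℝ) : ℝ :=
  (∑ j, tSketch k h s u j * tSketch k h s v j) - (∑ l, u l * v l) ^ k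

lemma ptsD_eq {k d m : ℕ} [NeZero m] (h : Fin k → Fin d → Fin m) (s : Fin k → Fin d → Bool)
    (u v : Fin d → ℝ) :
    ptsD h s u v = ∑ i : Fin k → Fin d, ∑ i' : Fin k → Fin d, if i = i' then 0 else
      (if (∑ t, h t (i t)) = ∑ t, h t (i' t) then (1 : ℝ) else 0) *
      ∏ t, (sgn (s t (i t)) * sgn (s t (i' t)) * (u (i t) * v (i' t))) := by
  have h1 : ∑ j, tSketch k h s u j * tSketch k h s v j
      = ∑ i : Fin k → Fin d, ∑ i' : Fin k → Fin d,
      (if (∑ t, h t (i t)) = ∑ t, h t (i' t) then (1 : ℝ) else 0) *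
      ∏ t, (sgn (s t (i t)) * sgn (s t (i' t)) * (u (i t) * v (i' t))) := by
    simp only [tSketch, Finset.sum_mul_sum]
    rw [Finset.sum_comm]
    refine Finset.sum_congr rfl fun i _ => ?_
    rw [Finset.sum_comm]
    refine Finset.sum_congr rfl fun i' _ => ?_
    simp only [ite_mul, zero_mul, Finset.sum_ite_eq, Finset.mem_univ, if_true, one_mul, mul_ite,
      mul_zero, ← Finset.prod_mul_distrib]
    by_cases hh : (∑ t, h t (i t)) = ∑ t, h t (i' t)
    · rw [if_pos hh, if_pos hh]
      refine Finset.prod_congr rfl fun t _ => ?_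
      ring
    · rw [if_neg hh, if_neg hh]
  have h2 : (∑ l, u l * v l) ^ k = ∑ i : Fin k → Fin d, ∑ i' : Fin k → Fin d,
      if i = i' then ∏ t, (u (i t) * v (i' t)) else 0 := by
    rw [Fintype.sum_pow]
    simp
  rw [ptsD, h1, h2, ← Finset.sum_sub_distrib]
  refine Finset.sum_congr rfl fun i _ => ?_
  rw [← Finset.sum_sub_distrib]
  refine Finset.sum_congr rfl fun i' _ => ?_
  by_cases hii : i = i'
  · subst hii
    simp [pts_sgn_sq]
  · simp [hii]

lemma pts_B_sum {d : ℕ} (u v : Fin d → ℝ) :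
    ∑ a, ∑ b, ∑ c, ∑ e, ptsB a b c e * (|u a * v b| * |u c * v e|)
      ≤ 3 * ((∑ l, u l ^ 2) * (∑ l, v l ^ 2)) := by
  have hcs : (∑ l, |u l| * |v l|) ^ 2 ≤ (∑ l, u l ^ 2) * (∑ l, v l ^ 2) := by
    simpa using Finset.sum_mul_sq_le_sq_mul_sq Finset.univ (fun l => |u l|) (fun l => |v l|)
  have e1 : ∑ a, ∑ b, ∑ c, ∑ e, (if a = b ∧ c = e then (1:ℝ) else 0) *
      (|u a * v b| * |u c * v e|) = (∑ l, |u l| * |v l|) ^ 2 := by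
    simp only [ite_and, ite_mul, one_mul, zero_mul, Finset.sum_ite_irrel, Finset.sum_const_zero,
      Finset.sum_ite_eq, Finset.mem_univ, if_true, abs_mul]
    rw [sq, Finset.sum_mul_sum]
  have e2 : ∑ a, ∑ b, ∑ c, ∑ e, (if a = c ∧ b = e then (1:ℝ) else 0) *
      (|u a * v b| * |u c * v e|) = (∑ l, u l ^ 2) * (∑ l, v l ^ 2) := by
    simp only [ite_and, ite_mul, one_mul, zero_mul, Finset.sum_ite_irrel, Finset.sum_const_zero,
      Finset.sum_ite_eq, Finset.mem_univ, if_true]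
    rw [Finset.sum_mul_sum]
    refine Finset.sum_congr rfl fun a _ => Finset.sum_congr rfl fun b _ => ?_
    rw [abs_mul_abs_self]; ring
  have e3 : ∑ a, ∑ b, ∑ c, ∑ e, (if a = e ∧ b = c then (1:ℝ) else 0) *
      (|u a * v b| * |u c * v e|) = (∑ l, |u l| * |v l|) ^ 2 := by
    have : ∀ a b c e : Fin d, (if a = e ∧ b = c then (1:ℝ) else 0) = 
      (if b = c ∧ a = e then (1:ℝ) else 0) := fun a b c e => by simp only [and_comm]
    simp only [this, ite_and, ite_mul, one_mul, zero_mul, Finset.sum_ite_irrel,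
      Finset.sum_const_zero, Finset.sum_ite_eq, Finset.mem_univ, if_true, abs_mul]
    rw [sq, Finset.sum_mul_sum]
    refine Finset.sum_congr rfl fun a _ => Finset.sum_congr rfl fun b _ => ?_
    ring
  simp only [ptsB, add_mul, Finset.sum_add_distrib, e1, e2, e3]
  linarith

lemma pts_pi_sum4 {d k : ℕ} (G : Fin d → Fin d → Fin d → Fin d → ℝ) :
    ∑ i : Fin k → Fin d, ∑ i' : Fin k → Fin d, ∑ p : Fin k → Fin d, ∑ p' : Fin k → Fin d,
      ∏ t, G (i t) (i' t) (p t) (p' t) = (∑ a, ∑ b, ∑ c, ∑ e, G a b c e) ^ k := by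
  have H : ∀ (F : Fin k → Fin d → ℝ), ∑ i : Fin k → Fin d, ∏ t, F t (i t) = ∏ t, ∑ a, F t a := by
    intro F
    rw [Finset.prod_univ_sum]; simp [Fintype.piFinset_univ]
  have : ∀ i i' p : Fin k → Fin d, ∑ p' : Fin k → Fin d, ∏ t, G (i t) (i' t) (p t) (p' t)
      = ∏ t, ∑ e, G (i t) (i' t) (p t) e := fun i i' p => H (fun t e => G (i t) (i' t) (p t) e)
  simp only [this]
  have : ∀ i i' : Fin k → Fin d, ∑ p : Fin k → Fin d, ∏ t, ∑ e, G (i t) (i' t) (p t) e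
      = ∏ t, ∑ c, ∑ e, G (i t) (i' t) c e :=
    fun i i' => H (fun t c => ∑ e, G (i t) (i' t) c e)
  simp only [this]
  have : ∀ i : Fin k → Fin d, ∑ i' : Fin k → Fin d, ∏ t, ∑ c, ∑ e, G (i t) (i' t) c e
      = ∏ t, ∑ b, ∑ c, ∑ e, G (i t) b c e :=
    fun i => H (fun t b => ∑ c, ∑ e, G (i t) b c e)
  simp only [this]
  rw [H (fun t a => ∑ b, ∑ c, ∑ e, G a b c e)]
  simp

lemma pts_second {k d m : ℕ} [NeZero m] (u v : Fin d → ℝ) :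
    (𝔼 h : Fin k → Fin d → Fin m, 𝔼 s : Fin k → Fin d → Bool, ptsD h s u v ^ 2)
      ≤ (3 ^ k * ((∑ l, u l ^ 2) ^ k * (∑ l, v l ^ 2) ^ k)) / m := by
  have hexp : ∀ (h : Fin k → Fin d → Fin m) (s : Fin k → Fin d → Bool), ptsD h s u v ^ 2
      = ∑ i : Fin k → Fin d, ∑ i' : Fin k → Fin d, ∑ p : Fin k → Fin d, ∑ p' : Fin k → Fin d,
        if i = i' ∨ p = p' then 0 else
        ((if (∑ t, h t (i t)) = ∑ t, h t (i' t) then (1 : ℝ) else 0) *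
        (if (∑ t, h t (p t)) = ∑ t, h t (p' t) then (1 : ℝ) else 0)) *
        ((∏ t, (sgn (s t (i t)) * sgn (s t (i' t)) * (sgn (s t (p t)) * sgn (s t (p' t)))))
          * ∏ t, ((u (i t) * v (i' t)) * (u (p t) * v (p' t)))) := by
    intro h s
    rw [ptsD_eq, sq, Finset.sum_mul]
    refine Finset.sum_congr rfl fun i _ => ?_
    rw [Finset.sum_mul]
    refine Finset.sum_congr rfl fun i' _ => ?_
    rw [Finset.mul_sum]
    refine Finset.sum_congr rfl fun p _ => ?_
    rw [Finset.mul_sum]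
    refine Finset.sum_congr rfl fun p' _ => ?_
    by_cases h1 : i = i'
    · simp [h1]
    by_cases h2 : p = p'
    · simp [h2]
    simp only [h1, h2, or_self, if_false]
    simp only [Finset.prod_mul_distrib]
    ring
  have hE : (𝔼 h : Fin k → Fin d → Fin m, 𝔼 s : Fin k → Fin d → Bool, ptsD h s u v ^ 2)
      = ∑ i : Fin k → Fin d, ∑ i' : Fin k → Fin d, ∑ p : Fin k → Fin d, ∑ p' : Fin k → Fin d,
        if i = i' ∨ p = p' then 0 else
        (𝔼 h : Fin k → Fin d → Fin m,
        (if (∑ t, h t (i t)) = ∑ t, h t (i' t) then (1 : ℝ) else 0) *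
        (if (∑ t, h t (p t)) = ∑ t, h t (p' t) then (1 : ℝ) else 0)) *
        ((∏ t, ptsE (i t) (i' t) (p t) (p' t))
          * ∏ t, ((u (i t) * v (i' t)) * (u (p t) * v (p' t)))) := by
    simp only [hexp, Finset.expect_sum_comm]
    refine Finset.sum_congr rfl fun i _ => Finset.sum_congr rfl fun i' _ =>
      Finset.sum_congr rfl fun p _ => Finset.sum_congr rfl fun p' _ => ?_
    by_cases h1 : i = i' ∨ p = p'
    · simp [h1]
    simp only [h1, if_false]
    simp only [← Finset.mul_expect, ← Finset.expect_mul]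
    congr 2
    exact pts_avg_prod (fun t (y : Fin d → Bool) =>
      sgn (y (i t)) * sgn (y (i' t)) * (sgn (y (p t)) * sgn (y (p' t))))
  rw [hE]
  have hm : (0 : ℝ) ≤ 1 / m := by positivity
  calc _ ≤ ∑ i : Fin k → Fin d, ∑ i' : Fin k → Fin d, ∑ p : Fin k → Fin d, ∑ p' : Fin k → Fin d,
        (1 / m : ℝ) * ∏ t, (ptsB (i t) (i' t) (p t) (p' t) *
          (|u (i t) * v (i' t)| * |u (p t) * v (p' t)|)) := by
        refine Finset.sum_le_sum fun i _ => Finset.sum_le_sum fun i' _ =>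
          Finset.sum_le_sum fun p _ => Finset.sum_le_sum fun p' _ => ?_
        have hB : ∀ a b c e : Fin d, 0 ≤ ptsB a b c e := fun a b c e =>
          (abs_nonneg _).trans (ptsE_abs_le a b c e)
        have hnn : 0 ≤ ∏ t, (ptsB (i t) (i' t) (p t) (p' t) *
          (|u (i t) * v (i' t)| * |u (p t) * v (p' t)|)) :=
          Finset.prod_nonneg fun t _ => mul_nonneg (hB _ _ _ _) (by positivity)
        split_ifs with h1
        · exact mul_nonneg hm hnn
        · refine (le_abs_self _).trans ?_
          rw [abs_mul]
          refine mul_le_mul (pts_coll2 i i' p p' (fun h => h1 (Or.inl h))) ?_ (abs_nonneg _) hm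
          rw [← Finset.prod_mul_distrib, Finset.abs_prod]
          refine Finset.prod_le_prod (fun t _ => abs_nonneg _) fun t _ => ?_
          rw [abs_mul, abs_mul (u (i t) * v (i' t))]
          exact mul_le_mul_of_nonneg_right (ptsE_abs_le _ _ _ _) (by positivity)
    _ = (1 / m : ℝ) * (∑ a, ∑ b, ∑ c, ∑ e, ptsB a b c e * (|u a * v b| * |u c * v e|)) ^ k := by
        rw [← pts_pi_sum4]
        simp only [Finset.mul_sum]
    _ ≤ (1 / m : ℝ) * (3 * ((∑ l, u l ^ 2) * (∑ l, v l ^ 2))) ^ k := by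
        refine mul_le_mul_of_nonneg_left (pow_le_pow_left₀ ?_ (pts_B_sum u v) k) hm
        have hB : ∀ a b c e : Fin d, 0 ≤ ptsB a b c e := fun a b c e =>
          (abs_nonneg _).trans (ptsE_abs_le a b c e)
        exact Finset.sum_nonneg fun a _ => Finset.sum_nonneg fun b _ => Finset.sum_nonneg fun c _ =>
          Finset.sum_nonneg fun e _ => mul_nonneg (hB _ _ _ _) (by positivity)
    _ = _ := by rw [mul_pow, mul_pow]; ring

lemma ptsD_zero {d m : ℕ} [NeZero m] (h : Fin 0 → Fin d → Fin m) (s : Fin 0 → Fin d → Bool)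
    (u v : Fin d → ℝ) : ptsD h s u v = 0 := by
  rw [ptsD_eq]
  refine Finset.sum_eq_zero fun i _ => Finset.sum_eq_zero fun i' _ => ?_
  rw [if_pos (Subsingleton.elim _ _)]

lemma pts_expHS_eq {k d m : ℕ} 
    (F : (Fin k → Fin d → Fin m) → (Fin k → Fin d → Bool) → ℝ) :
    expHS F = 𝔼 h : Fin k → Fin d → Fin m, 𝔼 s : Fin k → Fin d → Bool, F h s := by
  simp only [expHS, Fintype.expect_eq_sum_div_card]
  rw [← Finset.sum_div, div_div, mul_comm]

lemma pts_second' {k r d m : ℕ} [NeZero m] (hkr : k ≤ r) (u v : Fin d → ℝ) :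
    (𝔼 h : Fin r → Fin d → Fin m, 𝔼 s : Fin r → Fin d → Bool,
      ptsD (fun t : Fin k => h ⟨t.1, lt_of_lt_of_le t.2 hkr⟩)
        (fun t : Fin k => s ⟨t.1, lt_of_lt_of_le t.2 hkr⟩) u v ^ 2)
      ≤ (3 ^ k * ((∑ l, u l ^ 2) ^ k * (∑ l, v l ^ 2) ^ k)) / m := by
  refine le_trans (le_of_eq ?_) (pts_second (k := k) (m := m) u v)
  rw [← pts_avg_marginal hkr]
  refine Finset.expect_congr rfl fun h _ => ?_
  exact pts_avg_marginal hkr (fun s => ptsD (fun t : Fin k => h ⟨t.1, lt_of_lt_of_le t.2 hkr⟩)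
    s u v ^ 2)

/-- **Error bound for Poly-TensorSketch** (Proposition 1): if
`|f(x) − Σ_{j=0}^r c_j x^j| ≤ ε` on a closed interval containing every entry of
`UVᵀ`, then `E ‖f⊙(UVᵀ) − Γ‖_F² ≤ 2n²ε² +
Σ_{j=1}^r 2 r c_j² (2+3^j)(Σ_i(Σ_k U_{ik}²)^j)(Σ_i(Σ_k V_{ik}²)^j)/m`. -/
theorem polyTensorSketch_error_bound {n d m r : ℕ} [NeZero m]
    (U V : Matrix (Fin n) (Fin d) ℝ) (f : ℝ → ℝ) (c : Fin (r + 1) → ℝ)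
    (ε : ℝ) (hε : 0 < ε) (a b : ℝ)
    (hab : ∀ i j, (U * Vᵀ) i j ∈ Set.Icc a b)
    (happrox : ∀ x ∈ Set.Icc a b, |f x - ∑ ℓ : Fin (r + 1), c ℓ * x ^ (ℓ : ℕ)| ≤ ε) :
    expHS (fun (h : Fin r → Fin d → Fin m) (s : Fin r → Fin d → Bool) =>
      frobSq ((Matrix.of fun i j => f ((U * Vᵀ) i j)) - ptsGamma r c h s U V))
    ≤ 2 * (n : ℝ) ^ 2 * ε ^ 2
      + ∑ j : Fin r, 2 * (r : ℝ) * (c j.succ) ^ 2 * (2 + 3 ^ ((j : ℕ) + 1))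
          * (∑ i, (∑ l, (U i l) ^ 2) ^ ((j : ℕ) + 1))
          * (∑ i, (∑ l, (V i l) ^ 2) ^ ((j : ℕ) + 1)) / m := by
  have hpt : ∀ (h : Fin r → Fin d → Fin m) (s : Fin r → Fin d → Bool),
      frobSq ((Matrix.of fun i j => f ((U * Vᵀ) i j)) - ptsGamma r c h s U V)
      ≤ ∑ x : Fin n, ∑ y : Fin n, (2 * ε ^ 2 + ∑ j : Fin r, 2 * (r : ℝ) * (c j.succ) ^ 2 *
        ptsD (fun t : Fin (j + 1) => h ⟨t.1, lt_of_lt_of_le t.2 j.2⟩)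
        (fun t : Fin (j + 1) => s ⟨t.1, lt_of_lt_of_le t.2 j.2⟩) (U x) (V y) ^ 2) := by
    intro h s
    unfold frobSq
    refine Finset.sum_le_sum fun x _ => Finset.sum_le_sum fun y _ => ?_
    have hx : (U * Vᵀ) x y = ∑ l, U x l * V y l := by simp [Matrix.mul_apply]
    have hA := happrox _ (hab x y)
    set S := ∑ j : Fin r, c j.succ *
        ptsD (fun t : Fin (j + 1) => h ⟨t.1, lt_of_lt_of_le t.2 j.2⟩)
        (fun t : Fin (j + 1) => s ⟨t.1, lt_of_lt_of_le t.2 j.2⟩) (U x) (V y) with hS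
    have hG : ptsGamma r c h s U V x y
        = (∑ ℓ : Fin (r + 1), c ℓ * ((U * Vᵀ) x y) ^ (ℓ : ℕ)) + S := by
      have hG1 : ptsGamma r c h s U V x y = ∑ ℓ : Fin (r + 1), (c ℓ * ((U * Vᵀ) x y) ^ (ℓ : ℕ) +
          c ℓ * ptsD (fun t : Fin ℓ => h ⟨t.1, lt_of_lt_of_le t.2 (Nat.lt_succ_iff.mp ℓ.2)⟩)
          (fun t : Fin ℓ => s ⟨t.1, lt_of_lt_of_le t.2 (Nat.lt_succ_iff.mp ℓ.2)⟩)
          (U x) (V y)) := by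
        unfold ptsGamma
        rw [Matrix.sum_apply]
        refine Finset.sum_congr rfl fun ℓ _ => ?_
        rw [Matrix.smul_apply, Matrix.mul_apply, hx, ptsD, smul_eq_mul]
        simp only [tSketchM, Matrix.transpose_apply, Matrix.of_apply]
        ring
      rw [hG1, Finset.sum_add_distrib]
      congr 1
      rw [Fin.sum_univ_succ]
      have h0 := ptsD_zero (m := m) (d := d)
        (fun t : Fin 0 => h ⟨t.1, lt_of_lt_of_le t.2 (Nat.zero_le r)⟩)
        (fun t : Fin 0 => s ⟨t.1, lt_of_lt_of_le t.2 (Nat.zero_le r)⟩) (U x) (V y)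
      rw [hS]
      refine (congrArg₂ (· + ·) ?_ rfl).trans (zero_add _)
      exact (congrArg (c 0 * ·) h0).trans (mul_zero _)
    have hSq : S ^ 2 ≤ r * ∑ j : Fin r, (c j.succ *
        ptsD (fun t : Fin (j + 1) => h ⟨t.1, lt_of_lt_of_le t.2 j.2⟩)
        (fun t : Fin (j + 1) => s ⟨t.1, lt_of_lt_of_le t.2 j.2⟩) (U x) (V y)) ^ 2 := by
      simpa using sq_sum_le_card_mul_sum_sq (s := (Finset.univ : Finset (Fin r)))
        (f := fun j : Fin r => c j.succ *
        ptsD (fun t : Fin (j + 1) => h ⟨t.1, lt_of_lt_of_le t.2 j.2⟩)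
        (fun t : Fin (j + 1) => s ⟨t.1, lt_of_lt_of_le t.2 j.2⟩) (U x) (V y))
    rw [Matrix.sub_apply, Matrix.of_apply, hG]
    have hA2 := sq_le_sq' (abs_le.mp hA).1 (abs_le.mp hA).2
    have hrw : (∑ j : Fin r, 2 * (r : ℝ) * (c j.succ) ^ 2 *
        ptsD (fun t : Fin (j + 1) => h ⟨t.1, lt_of_lt_of_le t.2 j.2⟩)
        (fun t : Fin (j + 1) => s ⟨t.1, lt_of_lt_of_le t.2 j.2⟩) (U x) (V y) ^ 2)
        = 2 * (r * ∑ j : Fin r, (c j.succ *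
        ptsD (fun t : Fin (j + 1) => h ⟨t.1, lt_of_lt_of_le t.2 j.2⟩)
        (fun t : Fin (j + 1) => s ⟨t.1, lt_of_lt_of_le t.2 j.2⟩) (U x) (V y)) ^ 2) := by
      simp only [Finset.mul_sum]
      refine Finset.sum_congr rfl fun j _ => ?_
      ring
    rw [hrw]
    generalize (∑ ℓ : Fin (r + 1), c ℓ * ((U * Vᵀ) x y) ^ (ℓ : ℕ)) = P at *
    nlinarith [sq_nonneg (f ((U * Vᵀ) x y) - P + S)]
  rw [pts_expHS_eq]
  refine (Finset.expect_le_expect fun h _ => Finset.expect_le_expect fun s _ => hpt h s).trans ?_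
  simp only [Finset.expect_sum_comm, Finset.expect_add_distrib, ← Finset.mul_expect]
  simp only [Fintype.expect_const]
  calc _ ≤ ∑ x : Fin n, ∑ y : Fin n, (2 * ε ^ 2 + ∑ j : Fin r, 2 * (r : ℝ) * (c j.succ) ^ 2 *
        ((3 ^ ((j : ℕ) + 1) * ((∑ l, U x l ^ 2) ^ ((j : ℕ) + 1)
          * (∑ l, V y l ^ 2) ^ ((j : ℕ) + 1))) / m)) := by
        refine Finset.sum_le_sum fun x _ => Finset.sum_le_sum fun y _ => ?_
        refine add_le_add le_rfl (Finset.sum_le_sum fun j _ => ?_)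
        exact mul_le_mul_of_nonneg_left (pts_second' (k := (j : ℕ) + 1) j.2 (U x) (V y))
          (by positivity)
    _ = 2 * (n : ℝ) ^ 2 * ε ^ 2 + ∑ j : Fin r, 2 * (r : ℝ) * (c j.succ) ^ 2 * (3 ^ ((j : ℕ) + 1))
          * (∑ i, (∑ l, (U i l) ^ 2) ^ ((j : ℕ) + 1))
          * (∑ i, (∑ l, (V i l) ^ 2) ^ ((j : ℕ) + 1)) / m := by
        simp only [Finset.sum_add_distrib]
        congr 1
        · simp; ring
        · have : ∀ x : Fin n, ∑ y : Fin n, ∑ j : Fin r, 2 * (r : ℝ) * (c j.succ) ^ 2 *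
            ((3 ^ ((j : ℕ) + 1) * ((∑ l, U x l ^ 2) ^ ((j : ℕ) + 1)
            * (∑ l, V y l ^ 2) ^ ((j : ℕ) + 1))) / m) = ∑ j : Fin r, ∑ y : Fin n,
            2 * (r : ℝ) * (c j.succ) ^ 2 *
            ((3 ^ ((j : ℕ) + 1) * ((∑ l, U x l ^ 2) ^ ((j : ℕ) + 1)
            * (∑ l, V y l ^ 2) ^ ((j : ℕ) + 1))) / m) := fun x => Finset.sum_comm
          simp only [this]
          rw [Finset.sum_comm]
          refine Finset.sum_congr rfl fun j _ => ?_
          rw [mul_assoc (2 * (r : ℝ) * (c j.succ) ^ 2 * (3 ^ ((j : ℕ) + 1))), Finset.sum_mul_sum, mul_div_assoc, Finset.sum_div, Finset.mul_sum]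
          refine Finset.sum_congr rfl fun x _ => ?_
          rw [Finset.sum_div, Finset.mul_sum]
          refine Finset.sum_congr rfl fun y _ => ?_
          ring
    _ ≤ _ := by
        refine add_le_add le_rfl (Finset.sum_le_sum fun j _ => ?_)
        gcongr
        linarith
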